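/- arXiv:1806.10204 — 6 statements merged into one kernel-verified Lean document; each statement's English description precedes it below -/
import Mathlib

section
/- The ideal I^C of ℚ⟨a,b,c,d⟩ equals the two-sided ideal generated by the 16 elements ac, ad, ba, b², bc − a², bd − ab, c², cd, da, db, dc − ca, d² − cb, a³ − a, a²b − b, ca² − c, cab − d. -/
/-- The free unital associative ℚ-algebra ℚ⟨a,b,c,d⟩ on four generators
`a = e₁₁, b = e₁₂, c = e₂₁, d = e₂₂`. -/
abbrev FreeA : Type := FreeAlgebra ℚ (Fin 4)

/-- The generators `e₁₁ = a, e₁₂ = b, e₂₁ = c, e₂₂ = d` of ℚ⟨a,b,c,d⟩,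
indexed by pairs `(i,j)` with `i,j ∈ {1,2}`. -/
def gen (i j : Fin 2) : FreeA :=
  FreeAlgebra.ι ℚ (⟨2 * i.val + j.val, by omega⟩ : Fin 4)

/-- The 2×2 matrix units `E_ij` over ℚ. -/
noncomputable def matUnit (i j : Fin 2) : Matrix (Fin 2) (Fin 2) ℚ :=
  Matrix.single i j 1

/-- The ℚ-linear map `η : M₂(ℚ) → ℚ⟨a,b,c,d⟩` with `η(E_ij) = e_ij`. -/
noncomputable def eta (x : Matrix (Fin 2) (Fin 2) ℚ) : FreeA :=
  ∑ i : Fin 2, ∑ j : Fin 2, x i j • gen i j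

/-- The 64 generators `e_ij e_kl e_st − e_kl e_ij e_st − η([E_ij, E_kl, E_st])`
of the ideal `I^C`, coming from the special commutator `[x,y,z] = xyz − yxz`
on the associative triple system M₂(ℚ). -/
noncomputable def genSetC : Set FreeA :=
  { g | ∃ i j k l s t : Fin 2,
      g = gen i j * gen k l * gen s t - gen k l * gen i j * gen s t
          - eta (matUnit i j * matUnit k l * matUnit s t
                 - matUnit k l * matUnit i j * matUnit s t) }

/-- The two-sided ideal `I^C` of ℚ⟨a,b,c,d⟩. -/
noncomputable def idealC : TwoSidedIdeal FreeA := TwoSidedIdeal.span genSetC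

/-- Value of the special commutator on symbols `e i j`. -/
def brk {R : Type*} [Ring R] (e : Fin 2 → Fin 2 → R) (i j k l s t : Fin 2) : R :=
  (if j = k ∧ l = s then e i t else 0) - (if l = i ∧ j = s then e k t else 0)

theorem eta_brk (i j k l s t : Fin 2) :
    eta (matUnit i j * matUnit k l * matUnit s t
                 - matUnit k l * matUnit i j * matUnit s t) = brk gen i j k l s t := by
  unfold eta matUnit brk
  fin_cases i <;> fin_cases j <;> fin_cases k <;> fin_cases l <;> fin_cases s <;> fin_cases t <;>
    simp [Fin.sum_univ_two, Matrix.single_apply]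

theorem jac {R : Type*} [Ring R] (e : Fin 2 → Fin 2 → R)
    (H : ∀ i j k l s t, e i j * e k l * e s t - e k l * e i j * e s t = brk e i j k l s t)
    (i j k l s t m n : Fin 2) :
    (brk e k l s t i j + brk e s t i j k l + brk e i j k l s t) * e m n
      = e i j * brk e k l s t m n + e k l * brk e s t i j m n + e s t * brk e i j k l m n := by
  simp only [← H]
  noncomm_ring

/-- The sixteen relations hold in any 2-torsion-free ring satisfying the commutator relations. -/
theorem forward {R : Type*} [Ring R] (h2 : ∀ x : R, x + x = 0 → x = 0)
    (e : Fin 2 → Fin 2 → R)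
    (H : ∀ i j k l s t, e i j * e k l * e s t - e k l * e i j * e s t = brk e i j k l s t)
    (a b c d : R) (ha : e 0 0 = a) (hb : e 0 1 = b) (hc : e 1 0 = c) (hd : e 1 1 = d) :
    a * c = 0 ∧ a * d = 0 ∧ b * a = 0 ∧ b * b = 0 ∧ b * c - a * a = 0 ∧ b * d - a * b = 0 ∧
    c * c = 0 ∧ c * d = 0 ∧ d * a = 0 ∧ d * b = 0 ∧ d * c - c * a = 0 ∧ d * d - c * b = 0 ∧
    a * a * a - a = 0 ∧ a * a * b - b = 0 ∧ c * a * a - c = 0 ∧ c * a * b - d = 0 := by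
  have abca := jac e H 0 0 0 1 1 0 0 0
  have abcb := jac e H 0 0 0 1 1 0 0 1
  have abcc := jac e H 0 0 0 1 1 0 1 0
  have abcd := jac e H 0 0 0 1 1 0 1 1
  have abda := jac e H 0 0 0 1 1 1 0 0
  have abdb := jac e H 0 0 0 1 1 1 0 1
  have acda := jac e H 0 0 1 0 1 1 0 0
  have acdb := jac e H 0 0 1 0 1 1 0 1
  have acdc := jac e H 0 0 1 0 1 1 1 0
  have acdd := jac e H 0 0 1 0 1 1 1 1
  have bcda := jac e H 0 1 1 0 1 1 0 0
  have bcdb := jac e H 0 1 1 0 1 1 0 1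
  have habc := H 0 0 0 1 1 0
  have habd := H 0 0 0 1 1 1
  have hcab := H 1 0 0 0 0 1
  have hcbc := H 1 0 0 1 1 0
  have hbca := H 0 1 1 0 0 0
  have hcad := H 1 0 0 0 1 1
  have hbcb := H 0 1 1 0 0 1
  have hcbd := H 1 0 0 1 1 1
  have hacb := H 0 0 1 0 0 1
  simp [brk, ha, hb, hc, hd] at abca abcb abcc abcd abda abdb acda acdb acdc acdd bcda bcdb habc habd hcab hcbc hbca hcad hbcb hcbd hacb
  have ac : a * c = 0 := by
    apply h2
    linear_combination (norm := noncomm_ring) abcc - acda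
  have ad : a * d = 0 := by
    apply h2
    linear_combination (norm := noncomm_ring) abcd - acdb
  have da : d * a = 0 := by
    apply h2
    linear_combination (norm := noncomm_ring) - abca - bcda
  have db : d * b = 0 := by
    apply h2
    linear_combination (norm := noncomm_ring) - abcb - bcdb
  have bc : b * c = a * a := by
    linear_combination (norm := noncomm_ring) - abca + da
  have bd : b * d = a * b := by
    linear_combination (norm := noncomm_ring) - abcb + db
  have dc : d * c = c * a := by
    linear_combination (norm := noncomm_ring) acda - ac
  have dd : d * d = c * b := by
    linear_combination (norm := noncomm_ring) acdb - ad
  refine ⟨ac, ad, abda, abdb, sub_eq_zero.2 bc, sub_eq_zero.2 bd, acdc, acdd, da, db,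
    sub_eq_zero.2 dc, sub_eq_zero.2 dd, sub_eq_zero.2 ?_, sub_eq_zero.2 ?_, sub_eq_zero.2 ?_,
    sub_eq_zero.2 ?_⟩
  · rw [abda, mul_assoc, bc] at habc
    simpa [mul_assoc] using habc
  · rw [abda, mul_assoc, bd] at habd
    simpa [mul_assoc] using habd
  · rw [mul_assoc, mul_assoc b, acdc, bc] at hcbc
    simpa [mul_assoc] using hcbc
  · rw [ac] at hcab
    simpa [mul_assoc] using hcab

/-- The commutator relations hold in any ring satisfying the sixteen relations. -/
theorem backward {R : Type*} [Ring R] (e : Fin 2 → Fin 2 → R)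
    (a b c d : R) (ha : e 0 0 = a) (hb : e 0 1 = b) (hc : e 1 0 = c) (hd : e 1 1 = d)
    (ac : a * c = 0) (ad : a * d = 0) (ba : b * a = 0) (bb : b * b = 0)
    (bc : b * c = a * a) (bd : b * d = a * b) (cc : c * c = 0) (cd : c * d = 0)
    (da : d * a = 0) (db : d * b = 0) (dc : d * c = c * a) (dd : d * d = c * b)
    (aaa : a * a * a = a) (aab : a * a * b = b) (caa : c * a * a = c) (cab : c * a * b = d)
    (i j k l s t : Fin 2) :
    e i j * e k l * e s t - e k l * e i j * e s t = brk e i j k l s t := by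
  rw [mul_assoc] at aaa aab caa cab
  fin_cases i <;> fin_cases j <;> fin_cases k <;> fin_cases l <;> fin_cases s <;> fin_cases t <;>
    simp [brk, ha, hb, hc, hd, mul_assoc, ac, ad, ba, bb, bc, bd, cc, cd, da, db, dc, dd,
      aaa, aab, caa, cab]

theorem mem_iff_mk (I : TwoSidedIdeal FreeA) (x : FreeA) : x ∈ I ↔ I.ringCon.mk' x = 0 := by
  conv_lhs => rw [← TwoSidedIdeal.ker_ringCon_mk' I]
  exact TwoSidedIdeal.mem_ker _

theorem two_torsion_free (I : TwoSidedIdeal FreeA) (x : I.ringCon.Quotient) (h : x + x = 0) :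
    x = 0 := by
  have h1 : I.ringCon.mk' (algebraMap ℚ FreeA (1 / 2)) * 2 = 1 := by
    have : (2 : I.ringCon.Quotient) = I.ringCon.mk' (algebraMap ℚ FreeA 2) := by
      rw [map_ofNat, map_ofNat]
    rw [this, ← map_mul, ← map_mul]
    norm_num
  have h3 : (2 : I.ringCon.Quotient) * x = 0 := by rw [two_mul, h]
  calc x = (I.ringCon.mk' (algebraMap ℚ FreeA (1 / 2)) * 2) * x := by rw [h1, one_mul]
    _ = 0 := by rw [mul_assoc, h3, mul_zero]

theorem map_brk {R S : Type*} [Ring R] [Ring S] (f : R →+* S) (e : Fin 2 → Fin 2 → R)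
    (i j k l s t : Fin 2) :
    f (brk e i j k l s t) = brk (fun i j => f (e i j)) i j k l s t := by
  unfold brk
  split_ifs <;> simp

/-- The ideal `I^C` equals the two-sided ideal generated by the 16 listed elements,
where `a = e₁₁, b = e₁₂, c = e₂₁, d = e₂₂`. -/
theorem idealC_eq_span_sixteen :
    idealC = TwoSidedIdeal.span
      (let a := gen 0 0; let b := gen 0 1; let c := gen 1 0; let d := gen 1 1
       {a * c, a * d, b * a, b * b, b * c - a * a, b * d - a * b, c * c, c * d,
        d * a, d * b, d * c - c * a, d * d - c * b, a * a * a - a,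
        a * a * b - b, c * a * a - c, c * a * b - d}) := by
  apply le_antisymm
  · unfold idealC
    rw [TwoSidedIdeal.span_le]
    rintro _ ⟨i, j, k, l, s, t, rfl⟩
    rw [SetLike.mem_coe, eta_brk, mem_iff_mk, map_sub, map_brk, sub_eq_zero, map_sub]
    simp only [map_mul]
    refine backward (fun i j => RingCon.mk' _ (gen i j)) _ _ _ _ rfl rfl rfl rfl
      ?_ ?_ ?_ ?_ ?_ ?_ ?_ ?_ ?_ ?_ ?_ ?_ ?_ ?_ ?_ ?_ i j k l s t
    all_goals
      first
      | rw [← sub_eq_zero]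
        simp only [← map_mul, ← map_sub]
        rw [← mem_iff_mk]
        apply TwoSidedIdeal.subset_span
        simp
      | simp only [← map_mul]
        rw [← mem_iff_mk]
        apply TwoSidedIdeal.subset_span
        simp
  · rw [TwoSidedIdeal.span_le]
    have key := forward (two_torsion_free idealC) (fun i j => idealC.ringCon.mk' (gen i j))
      (by
        intro i j k l s t
        rw [← map_brk, ← sub_eq_zero]
        simp only [← map_mul, ← map_sub]
        rw [← mem_iff_mk, ← eta_brk]
        exact TwoSidedIdeal.subset_span ⟨i, j, k, l, s, t, rfl⟩) _ _ _ _ rfl rfl rfl rfl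
    simp only [← map_mul, ← map_sub] at key
    simp only [← mem_iff_mk] at key
    obtain ⟨h1, h2, h3, h4, h5, h6, h7, h8, h9, h10, h11, h12, h13, h14, h15, h16⟩ := key
    intro x hx
    simp only [Set.mem_insert_iff, Set.mem_singleton_iff] at hx
    rcases hx with rfl | rfl | rfl | rfl | rfl | rfl | rfl | rfl | rfl | rfl | rfl | rfl | rfl |
      rfl | rfl | rfl <;> assumption
end

section
/- The universal associative enveloping algebra U(A^C) = ℚ⟨a,b,c,d⟩/I^C is 9-dimensional over ℚ, with basis given by the cosets of the monomials 1, a, b, c, d, a², ab, ca, cb. -/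
/-- The relation on ℚ⟨a,b,c,d⟩ identifying each generator of `I^C` with 0;
quotienting by it yields ℚ⟨a,b,c,d⟩/I^C. -/
noncomputable def relC : FreeA → FreeA → Prop := fun x y => x ∈ genSetC ∧ y = 0

/-- The universal associative enveloping algebra `U(A^C) = ℚ⟨a,b,c,d⟩/I^C`. -/
noncomputable abbrev UC : Type := RingQuot relC

/-- The quotient map ℚ⟨a,b,c,d⟩ → U(A^C). -/
noncomputable def mkC : FreeA →ₐ[ℚ] UC := RingQuot.mkAlgHom ℚ relC

/-- The cosets of the monomials `1, a, b, c, d, a², ab, ca, cb` in `U(A^C)`. -/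
noncomputable def basisC : Fin 9 → UC :=
  let a := gen 0 0; let b := gen 0 1; let c := gen 1 0; let d := gen 1 1
  ![mkC 1, mkC a, mkC b, mkC c, mkC d, mkC (a * a), mkC (a * b),
    mkC (c * a), mkC (c * b)]

/-- The linear map `M₂(ℚ) → U(A^C)` induced by `η`. -/
noncomputable def EE : Matrix (Fin 2) (Fin 2) ℚ →ₗ[ℚ] UC where
  toFun x := mkC (eta x)
  map_add' x y := by
    simp only [eta, Matrix.add_apply, add_smul, Finset.sum_add_distrib, map_add]
  map_smul' r x := by
    simp only [eta, Matrix.smul_apply, smul_eq_mul, mul_smul, ← Finset.smul_sum, map_smul,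
      RingHom.id_apply]

theorem eta_matUnit (i j : Fin 2) : eta (matUnit i j) = gen i j := by
  fin_cases i <;> fin_cases j <;> simp [eta, matUnit, Fin.sum_univ_two, Matrix.single]

theorem EE_matUnit (i j : Fin 2) : EE (matUnit i j) = mkC (gen i j) :=
  congrArg mkC (eta_matUnit i j)

theorem rel_units (i j k l s t : Fin 2) :
    EE (matUnit i j) * EE (matUnit k l) * EE (matUnit s t)
      - EE (matUnit k l) * EE (matUnit i j) * EE (matUnit s t)
      = EE (matUnit i j * matUnit k l * matUnit s t - matUnit k l * matUnit i j * matUnit s t) := by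
  have h : relC (gen i j * gen k l * gen s t - gen k l * gen i j * gen s t
          - eta (matUnit i j * matUnit k l * matUnit s t
                 - matUnit k l * matUnit i j * matUnit s t)) 0 :=
    ⟨⟨i, j, k, l, s, t, rfl⟩, rfl⟩
  have h2 := RingQuot.mkAlgHom_rel ℚ h
  change mkC _ = mkC 0 at h2
  rw [map_zero, map_sub, map_sub, map_mul, map_mul, map_mul, map_mul, sub_eq_zero] at h2
  simp only [EE_matUnit]
  exact h2

theorem decomp (x : Matrix (Fin 2) (Fin 2) ℚ) :
    x = ∑ i : Fin 2, ∑ j : Fin 2, x i j • matUnit i j := by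
  ext p q
  fin_cases p <;> fin_cases q <;> simp [matUnit, Fin.sum_univ_two, Matrix.single]

theorem mat_ind {p : Matrix (Fin 2) (Fin 2) ℚ → Prop} (hu : ∀ i j, p (matUnit i j))
    (ha : ∀ x y, p x → p y → p (x + y)) (hs : ∀ (r : ℚ) x, p x → p (r • x)) (x) : p x := by
  rw [decomp x]
  simp only [Fin.sum_univ_two]
  exact ha _ _ (ha _ _ (hs _ _ (hu _ _)) (hs _ _ (hu _ _)))
    (ha _ _ (hs _ _ (hu _ _)) (hs _ _ (hu _ _)))

theorem rel_all (x y z : Matrix (Fin 2) (Fin 2) ℚ) :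
    EE x * EE y * EE z - EE y * EE x * EE z = EE (x * y * z - y * x * z) := by
  induction x using mat_ind with
  | ha x x' h h' =>
    rw [show (x + x') * y * z - y * (x + x') * z = (x * y * z - y * x * z) +
      (x' * y * z - y * x' * z) by noncomm_ring, map_add, map_add, ← h, ← h']
    noncomm_ring
  | hs r x h =>
    simp only [map_smul, smul_mul_assoc, mul_smul_comm, ← smul_sub]
    rw [← h]
    exact (smul_sub r _ _).symm
  | hu i j =>
  induction y using mat_ind with
  | ha x x' h h' =>
    rw [show matUnit i j * (x + x') * z - (x + x') * matUnit i j * z =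
      (matUnit i j * x * z - x * matUnit i j * z) +
      (matUnit i j * x' * z - x' * matUnit i j * z) by noncomm_ring, map_add, map_add, ← h, ← h']
    noncomm_ring
  | hs r x h =>
    simp only [map_smul, smul_mul_assoc, mul_smul_comm, ← smul_sub]
    rw [← h]
    exact (smul_sub r _ _).symm
  | hu k l =>
  induction z using mat_ind with
  | ha x x' h h' =>
    rw [mul_add, mul_add, add_sub_add_comm, map_add, map_add, ← h, ← h']
    noncomm_ring
  | hs r x h =>
    simp only [map_smul, mul_smul_comm, ← smul_sub]
    rw [← h]
    exact (smul_sub r _ _).symm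
  | hu s t => exact rel_units i j k l s t

/-- Deviation from being a homomorphism of associative triple systems. -/
noncomputable def DD (x y t : Matrix (Fin 2) (Fin 2) ℚ) : UC :=
  EE x * EE y * EE t - EE (x * y * t)

theorem DD_symm (x y t) : DD x y t = DD y x t := by
  have h := rel_all x y t
  rw [map_sub] at h
  unfold DD
  linear_combination (norm := abel) h

theorem DD_sub (x y y' t) : DD x (y - y') t = DD x y t - DD x y' t := by
  unfold DD
  rw [mul_sub, sub_mul, map_sub, map_sub, mul_sub, sub_mul]
  abel

theorem DD_comm (x y g : Matrix (Fin 2) (Fin 2) ℚ) (hg : x * y - y * x = g) (w z t) :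
    DD w (g * z) t = DD z (g * w) t := by
  have hC : ∀ z, (EE x * EE y - EE y * EE x) * EE z = EE (g * z) := by
    intro z
    rw [← hg, sub_mul, rel_all, sub_mul]
  have h1 : (EE x * EE y - EE y * EE x) * ((EE z * EE w * EE t) - (EE w * EE z * EE t))
      = EE (g * (z * w * t - w * z * t)) := by
    rw [rel_all, hC]
  rw [mul_sub, ← mul_assoc, ← mul_assoc, ← mul_assoc, ← mul_assoc, hC, hC] at h1
  have h2 := rel_all (g * z) w t
  have h3 := rel_all (g * w) z t
  unfold DD
  simp only [mul_sub, map_sub, ← mul_assoc] at h1 h2 h3 ⊢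
  linear_combination (norm := abel) h1 - h2 + h3

theorem DD_zero (w z t) : DD w z t = 0 := by
  have e1 : matUnit 0 0 * matUnit 0 1 - matUnit 0 1 * matUnit 0 0 = matUnit 0 1 := by
    simp [matUnit]
  have e2 : matUnit 1 0 * matUnit 0 0 - matUnit 0 0 * matUnit 1 0 = matUnit 1 0 := by
    simp [matUnit]
  obtain ⟨H, hH⟩ : ∃ H, matUnit 0 1 * matUnit 1 0 - matUnit 1 0 * matUnit 0 1 = H := ⟨_, rfl⟩
  have hHH : H * H = 1 := by
    rw [← hH]
    ext p q
    fin_cases p <;> fin_cases q <;> simp [matUnit, Matrix.mul_apply, Matrix.single]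
  have key : ∀ z, DD w (H * z) t = 0 := by
    intro z
    have a1 := DD_comm _ _ H hH w z t
    have a2 : DD w (matUnit 0 1 * (matUnit 1 0 * z)) t
        = DD z (matUnit 1 0 * (matUnit 0 1 * w)) t := by
      rw [DD_comm _ _ _ e1, DD_symm, DD_comm _ _ _ e2]
    have a3 : DD w (matUnit 1 0 * (matUnit 0 1 * z)) t
        = DD z (matUnit 0 1 * (matUnit 1 0 * w)) t := by
      rw [DD_comm _ _ _ e2, DD_symm, DD_comm _ _ _ e1]
    have a4 : DD w (H * z) t = - DD z (H * w) t := by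
      rw [← hH, sub_mul, sub_mul, DD_sub, DD_sub, mul_assoc, mul_assoc, mul_assoc, mul_assoc,
        a2, a3]
      abel
    rw [← a1] at a4
    have a5 : (2 : ℚ) • DD w (H * z) t = 0 := by
      rw [two_smul]
      exact add_eq_zero_iff_eq_neg.mpr a4
    exact (smul_eq_zero.mp a5).resolve_left two_ne_zero
  have := key (H * z)
  rwa [← mul_assoc, hHH, one_mul] at this

theorem triple (x y z) : EE x * EE y * EE z = EE (x * y * z) := sub_eq_zero.mp (DD_zero x y z)

/-- Images of the generators. -/
noncomputable def ge (i j : Fin 2) : UC := EE (matUnit i j)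

theorem matUnit_mul (i j k l : Fin 2) :
    matUnit i j * matUnit k l = if j = k then matUnit i l else 0 := by
  by_cases h : j = k
  · subst h; simp [matUnit]
  · simp [matUnit, h]

theorem ge3 (i j k l s t : Fin 2) :
    ge i j * ge k l * ge s t = if j = k ∧ l = s then ge i t else 0 := by
  unfold ge
  rw [triple, matUnit_mul]
  by_cases h : j = k <;> by_cases h' : l = s <;> simp [h, h', matUnit_mul]

theorem ge2 (i j k l : Fin 2) :
    ge i j * ge k l = if j = k then ge i 0 * ge 0 l else 0 := by
  have h : ge i j = ge i 0 * ge 0 0 * ge 0 j := by rw [ge3]; simp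
  rw [h, mul_assoc, mul_assoc, ← mul_assoc (ge 0 0), ge3]
  by_cases h : j = k <;> simp [h]

theorem basisC_eq : basisC = ![1, ge 0 0, ge 0 1, ge 1 0, ge 1 1, ge 0 0 * ge 0 0,
    ge 0 0 * ge 0 1, ge 1 0 * ge 0 0, ge 1 0 * ge 0 1] := by
  simp only [basisC, ge, EE_matUnit, map_mul, map_one]

theorem span_top : Submodule.span ℚ (Set.range basisC) = ⊤ := by
  set S := Submodule.span ℚ (Set.range basisC) with hS
  have hb : ∀ n, basisC n ∈ S := fun n => Submodule.subset_span ⟨n, rfl⟩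
  have h1 : (1 : UC) ∈ S := by have := hb 0; simpa [basisC_eq] using this
  have hg : ∀ i j, ge i j ∈ S := by
    intro i j
    have h1 := hb 1
    have h2 := hb 2
    have h3 := hb 3
    have h4 := hb 4
    simp only [basisC_eq] at h1 h2 h3 h4
    fin_cases i <;> fin_cases j
    exacts [h1, h2, h3, h4]
  have hgg0 : ∀ i l, ge i 0 * ge 0 l ∈ S := by
    intro i j
    have h1 := hb 5
    have h2 := hb 6
    have h3 := hb 7
    have h4 := hb 8
    simp only [basisC_eq] at h1 h2 h3 h4
    fin_cases i <;> fin_cases j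
    exacts [h1, h2, h3, h4]
  have hgg : ∀ i j k l, ge i j * ge k l ∈ S := by
    intro i j k l
    rw [ge2]
    split_ifs
    · exact hgg0 _ _
    · exact S.zero_mem
  have hggg : ∀ i j k l s t, ge i j * (ge k l * ge s t) ∈ S := by
    intro i j k l s t
    rw [← mul_assoc, ge3]
    split_ifs
    · exact hg _ _
    · exact S.zero_mem
  have hmul : ∀ i j, ∀ x ∈ S, ge i j * x ∈ S := by
    intro i j x hx
    refine Submodule.span_induction (p := fun x _ => ge i j * x ∈ S) ?_ ?_ ?_ ?_ hx
    · rintro _ ⟨n, rfl⟩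
      rw [basisC_eq]
      fin_cases n
      · change ge i j * 1 ∈ S
        rw [mul_one]; exact hg _ _
      exacts [hgg _ _ _ _, hgg _ _ _ _, hgg _ _ _ _, hgg _ _ _ _, hggg _ _ _ _ _ _,
        hggg _ _ _ _ _ _, hggg _ _ _ _ _ _, hggg _ _ _ _ _ _]
    · simp
    · intro x y _ _ hx hy
      rw [mul_add]; exact S.add_mem hx hy
    · intro r x _ hx
      rw [mul_smul_comm]; exact S.smul_mem _ hx
  have hι : ∀ n : Fin 4, ∃ i j, mkC (FreeAlgebra.ι ℚ n) = ge i j := by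
    intro n
    simp only [ge, EE_matUnit]
    fin_cases n
    exacts [⟨0, 0, rfl⟩, ⟨0, 1, rfl⟩, ⟨1, 0, rfl⟩, ⟨1, 1, rfl⟩]
  have hall : ∀ f : FreeA, ∀ x ∈ S, mkC f * x ∈ S := by
    intro f
    induction f using FreeAlgebra.induction with
    | grade0 r =>
      intro x hx
      rw [AlgHom.commutes, ← Algebra.smul_def]; exact S.smul_mem _ hx
    | grade1 n =>
      intro x hx
      obtain ⟨i, j, h⟩ := hι n
      rw [h]; exact hmul i j x hx
    | mul a b ha hb =>
      intro x hx
      rw [map_mul, mul_assoc]; exact ha _ (hb _ hx)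
    | add a b ha hb =>
      intro x hx
      rw [map_add, add_mul]; exact S.add_mem (ha _ hx) (hb _ hx)
  rw [eq_top_iff]
  intro u _
  obtain ⟨f, rfl⟩ := RingQuot.mkAlgHom_surjective ℚ relC u
  have := hall f 1 h1
  rwa [mul_one] at this

/-- The target of the model `ℚ × M₂ × M₂`. -/
abbrev Mod9 : Type := ℚ × Matrix (Fin 2) (Fin 2) ℚ × Matrix (Fin 2) (Fin 2) ℚ

/-- The representation `x ↦ (0, x, -x)` on the free algebra. -/
noncomputable def repF : FreeA →ₐ[ℚ] Mod9 :=
  FreeAlgebra.lift ℚ (fun n : Fin 4 =>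
    ((0, ![matUnit 0 0, matUnit 0 1, matUnit 1 0, matUnit 1 1] n,
      -(![matUnit 0 0, matUnit 0 1, matUnit 1 0, matUnit 1 1] n)) : Mod9))

theorem repF_gen (i j : Fin 2) : repF (gen i j) = (0, matUnit i j, -matUnit i j) := by
  unfold repF gen
  rw [FreeAlgebra.lift_ι_apply]
  fin_cases i <;> fin_cases j <;> rfl

theorem repF_eta (x) : repF (eta x) = (0, x, -x) := by
  conv_rhs => rw [decomp x]
  simp [eta, Fin.sum_univ_two, repF_gen]
  abel

theorem repF_rel ⦃x y : FreeA⦄ (h : relC x y) : repF x = repF y := by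
  obtain ⟨⟨i, j, k, l, s, t, rfl⟩, rfl⟩ := h
  simp only [map_sub, map_mul, map_zero, repF_gen, repF_eta]
  ext1
  · simp
  · ext1
    · simp
    · simp
      abel

/-- The representation on `U(A^C)`. -/
noncomputable def rep : UC →ₐ[ℚ] Mod9 := RingQuot.liftAlgHom ℚ ⟨repF, repF_rel⟩

theorem rep_mk (f) : rep (mkC f) = repF f := RingQuot.liftAlgHom_mkAlgHom_apply ..

theorem rep_ge (i j : Fin 2) : rep (ge i j) = (0, matUnit i j, -matUnit i j) := by
  rw [ge, EE_matUnit, rep_mk, repF_gen]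

theorem linInd : LinearIndependent ℚ basisC := by
  rw [Fintype.linearIndependent_iff]
  intro g hg
  have h := congrArg rep hg
  rw [basisC_eq] at h
  simp only [Fin.sum_univ_succ, map_add, map_smul, map_mul, map_zero] at h
  simp [rep_ge, matUnit_mul] at h
  have h0 := congrArg (fun v : Mod9 => v.1) h
  have h1 := congrArg (fun v : Mod9 => v.2.1) h
  have h2 := congrArg (fun v : Mod9 => v.2.2) h
  simp at h0 h1 h2
  have p := fun i j => congrFun (congrFun h1 i) j
  have q := fun i j => congrFun (congrFun h2 i) j
  have p00 := p 0 0
  have p01 := p 0 1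
  have p10 := p 1 0
  have p11 := p 1 1
  have q00 := q 0 0
  have q01 := q 0 1
  have q10 := q 1 0
  have q11 := q 1 1
  simp [matUnit, Matrix.single, h0] at p00 p01 p10 p11 q00 q01 q10 q11
  intro i
  fin_cases i <;> simp <;> linarith

/-- `U(A^C)` is 9-dimensional over ℚ, with basis given by the cosets of the
monomials `1, a, b, c, d, a², ab, ca, cb`. -/
theorem UC_dimension_nine :
    Module.finrank ℚ UC = 9 ∧
    LinearIndependent ℚ basisC ∧
    Submodule.span ℚ (Set.range basisC) = ⊤ := by
  refine ⟨?_, linInd, span_top⟩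
  rw [Module.finrank_eq_card_basis (Module.Basis.mk linInd span_top.ge), Fintype.card_fin]
end

section
/- The center of the universal associative enveloping algebra U(A^C) = ℚ⟨a,b,c,d⟩/I^C is 3-dimensional over ℚ, with basis given by the cosets of 1, a + d, and a² + cb. -/
/-- The cosets of `1`, `a + d`, `a² + cb` in `U(A^C)`. -/
noncomputable def centerBasisC : Fin 3 → UC :=
  let a := gen 0 0; let b := gen 0 1; let c := gen 1 0; let d := gen 1 1
  ![mkC 1, mkC (a + d), mkC (a * a + c * b)]

set_option linter.unusedSimpArgs false

/-- Target of the comparison map. -/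
abbrev Tgt : Type := Matrix (Fin 2) (Fin 2) ℚ × Matrix (Fin 2) (Fin 2) ℚ × ℚ

/-- Images of the generators. -/
noncomputable def phiGen (n : Fin 4) : Tgt :=
  (![matUnit 0 0, matUnit 0 1, matUnit 1 0, matUnit 1 1] n,
    -![matUnit 0 0, matUnit 0 1, matUnit 1 0, matUnit 1 1] n, 0)

/-- The lift to the free algebra. -/
noncomputable def phiFree : FreeA →ₐ[ℚ] Tgt := FreeAlgebra.lift ℚ phiGen

theorem phiFree_gen (i j : Fin 2) :
    phiFree (gen i j) = (matUnit i j, -matUnit i j, 0) := by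
  unfold phiFree gen
  rw [FreeAlgebra.lift_ι_apply]
  fin_cases i <;> fin_cases j <;> rfl

theorem phiFree_eta (x : Matrix (Fin 2) (Fin 2) ℚ) :
    phiFree (eta x) = (x, -x, 0) := by
  simp only [eta, map_add, map_smul, phiFree_gen, Fin.sum_univ_two]
  ext i j
  · fin_cases i <;> fin_cases j <;> simp [matUnit, Matrix.single_apply]
  · fin_cases i <;> fin_cases j <;> simp [matUnit, Matrix.single_apply]
  · simp

/-- The comparison map `U(A^C) → M₂ × M₂ × ℚ`. -/
noncomputable def phi : UC →ₐ[ℚ] Tgt :=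
  RingQuot.liftAlgHom ℚ ⟨phiFree, by
    rintro x y ⟨⟨i, j, k, l, s, t, rfl⟩, rfl⟩
    simp only [map_sub, map_mul, phiFree_gen, phiFree_eta, map_zero]
    refine Prod.ext ?_ (Prod.ext ?_ ?_)
    · simp
    · simp only [Prod.mk_mul_mk, Prod.mk_sub_mk, Prod.fst_zero, Prod.snd_zero]
      noncomm_ring
    · simp⟩

theorem phi_mk (x : FreeA) : phi (mkC x) = phiFree x := by
  unfold phi mkC
  exact RingQuot.liftAlgHom_mkAlgHom_apply ℚ _ _ _

/-- The image of a generator in the quotient. -/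
noncomputable def g (i j : Fin 2) : UC := mkC (gen i j)

theorem phi_g (i j : Fin 2) : phi (g i j) = (matUnit i j, -matUnit i j, 0) := by
  rw [g, phi_mk, phiFree_gen]

theorem g_rel (i j k l s t : Fin 2) :
    g i j * g k l * g s t - g k l * g i j * g s t =
      (if j = k ∧ l = s then g i t else 0) - (if l = i ∧ j = s then g k t else 0) := by
  have h : mkC (gen i j * gen k l * gen s t - gen k l * gen i j * gen s t
          - eta (matUnit i j * matUnit k l * matUnit s t
                 - matUnit k l * matUnit i j * matUnit s t)) = mkC 0 := by
    unfold mkC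
    exact RingQuot.mkAlgHom_rel ℚ ⟨⟨i, j, k, l, s, t, rfl⟩, rfl⟩
  rw [map_zero, map_sub, sub_eq_zero] at h
  simp only [map_sub, map_mul] at h
  change g i j * g k l * g s t - g k l * g i j * g s t = _ at h
  rw [h]
  have key : ∀ (i j k l s t : Fin 2), matUnit i j * matUnit k l * matUnit s t =
      if j = k ∧ l = s then matUnit i t else 0 := by
    intro i j k l s t
    unfold matUnit
    by_cases h1 : j = k
    · subst h1
      by_cases h2 : l = s
      · subst h2; simp
      · simp [h2]
    · simp [h1]
  have e1 : ∀ i j : Fin 2, mkC (eta (matUnit i j)) = g i j := by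
    intro i j
    unfold g eta
    congr 1
    fin_cases i <;> fin_cases j <;> simp [matUnit, Matrix.single_apply, Fin.sum_univ_two]
  have e0 : mkC (eta 0) = 0 := by simp [eta]
  have es : ∀ x y, mkC (eta (x - y)) = mkC (eta x) - mkC (eta y) := by
    intro x y
    rw [← map_sub]
    congr 1
    simp [eta, sub_smul, Finset.sum_sub_distrib]
  rw [es, key, key]
  congr 1
  · split_ifs <;> simp [e1, e0]
  · split_ifs <;> simp [e1, e0]

/-- The rewriting rules, derived in an arbitrary ring. -/
theorem rules {R : Type*} [Ring R] (g : Fin 2 → Fin 2 → R)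
    (H : ∀ i j k l s t : Fin 2, g i j * g k l * g s t - g k l * g i j * g s t =
      (if j = k ∧ l = s then g i t else 0) - (if l = i ∧ j = s then g k t else 0))
    (a b c d : R) (ha : g 0 0 = a) (hb : g 0 1 = b) (hc : g 1 0 = c) (hd : g 1 1 = d) :
    (a * c = 0 ∧ a * d = 0 ∧ b * a = 0 ∧ b * b = 0 ∧ b * c = a * a ∧ b * d = a * b) ∧
    (c * c = 0 ∧ c * d = 0 ∧ d * a = 0 ∧ d * b = 0 ∧ d * c = c * a ∧ d * d = c * b) ∧
    (a * (a * a) = a ∧ a * (a * b) = b ∧ c * (a * a) = c ∧ c * (a * b) = d) := by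
  obtain ⟨p, hp⟩ : ∃ p, p = a * b - b * a := ⟨_, rfl⟩
  obtain ⟨q, hq⟩ : ∃ q, q = c * a - a * c := ⟨_, rfl⟩
  have pa : p * a = 0 := by
    have := H 0 0 0 1 0 0; simp [ha, hb, hc, hd] at this; rw [hp, sub_mul]; exact this
  have pb : p * b = 0 := by
    have := H 0 0 0 1 0 1; simp [ha, hb, hc, hd] at this; rw [hp, sub_mul]; exact this
  have pc : p * c = a := by
    have := H 0 0 0 1 1 0; simp [ha, hb, hc, hd] at this; rw [hp, sub_mul]; exact this
  have pd : p * d = b := by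
    have := H 0 0 0 1 1 1; simp [ha, hb, hc, hd] at this; rw [hp, sub_mul]; exact this
  have qa : q * a = c := by
    have := H 1 0 0 0 0 0; simp [ha, hb, hc, hd] at this; rw [hq, sub_mul]; exact this
  have qb : q * b = d := by
    have := H 1 0 0 0 0 1; simp [ha, hb, hc, hd] at this; rw [hq, sub_mul]; exact this
  have qc : q * c = 0 := by
    have := H 1 0 0 0 1 0; simp [ha, hb, hc, hd] at this; rw [hq, sub_mul]; exact this
  have qd : q * d = 0 := by
    have := H 1 0 0 0 1 1; simp [ha, hb, hc, hd] at this; rw [hq, sub_mul]; exact this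
  have E : ∀ k l s t : Fin 2, (a + d) * (g k l * g s t) = g k l * ((a + d) * g s t) := by
    intro k l s t
    have h1 := H 0 0 k l s t
    have h2 := H 1 1 k l s t
    have h3 : (a * g k l * g s t - g k l * a * g s t)
        + (d * g k l * g s t - g k l * d * g s t) = 0 := by
      rw [← ha, ← hd, h1, h2]
      fin_cases k <;> fin_cases l <;> fin_cases s <;> simp
    rw [← sub_eq_zero, ← h3]
    noncomm_ring
  -- `a + d` commutes with `p` and `q` in front of a generator and of a product
  have E2 : ∀ (k l m n : Fin 2) (s t : Fin 2), (a + d) * (g k l * g m n * g s t) =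
      g k l * g m n * ((a + d) * g s t) := by
    intro k l m n s t
    have h1 : (a + d) * (g k l * g m n) = g k l * ((a + d) * g m n) := E k l m n
    calc (a + d) * (g k l * g m n * g s t) = (a + d) * (g k l * g m n) * g s t := by
          simp only [mul_assoc]
      _ = g k l * ((a + d) * (g m n * g s t)) := by rw [h1]; simp only [mul_assoc]
      _ = _ := by rw [E m n s t]; simp only [mul_assoc]
  have Ep : ∀ s t, (a + d) * (p * g s t) = p * ((a + d) * g s t) := by
    intro s t
    have h1 := E2 0 0 0 1 s t
    have h2 := E2 0 1 0 0 s t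
    rw [ha, hb] at h1 h2
    rw [hp, sub_mul, sub_mul, mul_sub, h1, h2]
  have Eq : ∀ s t, (a + d) * (q * g s t) = q * ((a + d) * g s t) := by
    intro s t
    have h1 := E2 1 0 0 0 s t
    have h2 := E2 0 0 1 0 s t
    rw [ha, hc] at h1 h2
    rw [hq, sub_mul, sub_mul, mul_sub, h1, h2]
  have ea : (a + d) * c = q * ((a + d) * a) := by have := Eq 0 0; rwa [ha, qa] at this
  have eb : (a + d) * d = q * ((a + d) * b) := by have := Eq 0 1; rwa [hb, qb] at this
  have ec : (a + d) * a = p * ((a + d) * c) := by have := Ep 1 0; rwa [hc, pc] at this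
  have ed : (a + d) * b = p * ((a + d) * d) := by have := Ep 1 1; rwa [hd, pd] at this
  have ea' : (a + d) * c = c * a := by
    rw [ea, add_mul, mul_add, ← mul_assoc, ← mul_assoc, qa, qd]; simp
  have eb' : (a + d) * d = c * b := by
    rw [eb, add_mul, mul_add, ← mul_assoc, ← mul_assoc, qa, qd]; simp
  have ec' : (a + d) * a = a * a := by
    rw [ec, ea', ← mul_assoc, pc]
  have ed' : (a + d) * b = a * b := by
    rw [ed, eb', ← mul_assoc, pc]
  have da : d * a = 0 := by rw [add_mul] at ec'; simpa using ec'
  have db : d * b = 0 := by rw [add_mul] at ed'; simpa using ed'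
  have bc : b * c = a * a := by
    have h : p * ((a + d) * c) = b * c := by
      rw [add_mul, mul_add, ← mul_assoc, ← mul_assoc, pa, pd]; simp
    rw [← h, ← ec, ec']
  have bd : b * d = a * b := by
    have h : p * ((a + d) * d) = b * d := by
      rw [add_mul, mul_add, ← mul_assoc, ← mul_assoc, pa, pd]; simp
    rw [← h, ← ed, ed']
  have dc : d * c = c * a := by rw [← qb, mul_assoc, bc, ← mul_assoc, qa]
  have dd : d * d = c * b := by
    nth_rewrite 1 [← qb]
    rw [mul_assoc, bd, ← mul_assoc, qa]
  have ac : a * c = 0 := by rw [add_mul, dc] at ea'; simpa using ea'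
  have ad : a * d = 0 := by rw [add_mul, dd] at eb'; simpa using eb'
  have ba : b * a = 0 := by rw [← pd, mul_assoc, da, mul_zero]
  have bb : b * b = 0 := by nth_rewrite 1 [← pd]; rw [mul_assoc, db, mul_zero]
  have cc : c * c = 0 := by nth_rewrite 1 [← qa]; rw [mul_assoc, ac, mul_zero]
  have cd : c * d = 0 := by nth_rewrite 1 [← qa]; rw [mul_assoc, ad, mul_zero]
  refine ⟨⟨ac, ad, ba, bb, bc, bd⟩, ⟨cc, cd, da, db, dc, dd⟩, ?_, ?_, ?_, ?_⟩
  · have := H 0 0 0 1 1 0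
    simp [ha, hb, hc, hd] at this
    simpa [ba, mul_assoc, bc] using this
  · have := H 0 0 0 1 1 1
    simp [ha, hb, hc, hd] at this
    simpa [ba, mul_assoc, bd] using this
  · have := H 1 0 0 1 1 0
    simp [ha, hb, hc, hd] at this
    rw [mul_assoc b, cc, mul_zero, sub_zero, mul_assoc, bc] at this
    exact this
  · have := H 1 0 0 1 1 1
    simp [ha, hb, hc, hd] at this
    simpa [cd, mul_assoc, bd] using this

/-- A general combination of the nine normal words. -/
noncomputable def comb (z : ℚ) (u v : Fin 2 → Fin 2 → ℚ) : UC :=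
  z • 1 + (u 0 0 • g 0 0 + u 0 1 • g 0 1 + u 1 0 • g 1 0 + u 1 1 • g 1 1)
    + (v 0 0 • (g 0 0 * g 0 0) + v 0 1 • (g 0 0 * g 0 1)
      + v 1 0 • (g 1 0 * g 0 0) + v 1 1 • (g 1 0 * g 0 1))

theorem comb_add (z z' : ℚ) (u u' v v' : Fin 2 → Fin 2 → ℚ) :
    comb z u v + comb z' u' v' = comb (z + z') (u + u') (v + v') := by
  simp only [comb, Pi.add_apply]
  module

theorem gen_mul_comb (i j : Fin 2) (z : ℚ) (u v : Fin 2 → Fin 2 → ℚ) :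
    g i j * comb z u v = comb 0
      (fun s t => if s = i then v j t + (if t = j then z else 0) else 0)
      (fun s t => if s = i then u j t else 0) := by
  obtain ⟨⟨ac, ad, ba, bb, bc, bd⟩, ⟨cc, cd, da, db, dc, dd⟩, aaa, aab, caa, cab⟩ :=
    rules g g_rel _ _ _ _ rfl rfl rfl rfl
  have bx : ∀ x, g 0 1 * (g 0 0 * x) = 0 := fun x => by rw [← mul_assoc, ba, zero_mul]
  have dx : ∀ x, g 1 1 * (g 0 0 * x) = 0 := fun x => by rw [← mul_assoc, da, zero_mul]
  have ax : ∀ x, g 0 0 * (g 1 0 * x) = 0 := fun x => by rw [← mul_assoc, ac, zero_mul]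
  have cx : ∀ x, g 1 0 * (g 1 0 * x) = 0 := fun x => by rw [← mul_assoc, cc, zero_mul]
  have hby : ∀ x, g 0 1 * (g 1 0 * x) = g 0 0 * (g 0 0 * x) := fun x => by
    rw [← mul_assoc, bc, mul_assoc]
  have dy : ∀ x, g 1 1 * (g 1 0 * x) = g 1 0 * (g 0 0 * x) := fun x => by
    rw [← mul_assoc, dc, mul_assoc]
  fin_cases i <;> fin_cases j <;>
    simp [comb, mul_add, ac, ad, ba, bb, bc, bd, cc, cd, da, db, dc, dd, aaa, aab, caa, cab,
      bx, dx, ax, cx, hby, dy] <;> module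

theorem exists_comb (x : UC) : ∃ z u v, x = comb z u v := by
  have main : ∀ f : FreeA, ∀ y : UC, (∃ z u v, y = comb z u v) →
      ∃ z u v, mkC f * y = comb z u v := by
    intro f
    induction f using FreeAlgebra.induction with
    | grade0 r =>
      rintro y ⟨z, u, v, rfl⟩
      refine ⟨r * z, r • u, r • v, ?_⟩
      rw [AlgHom.commutes, ← Algebra.smul_def]
      simp only [comb, Pi.smul_apply, smul_eq_mul]
      module
    | grade1 n =>
      rintro y ⟨z, u, v, rfl⟩
      have : ∃ i j, mkC (FreeAlgebra.ι ℚ n) = g i j := by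
        fin_cases n
        · exact ⟨0, 0, rfl⟩
        · exact ⟨0, 1, rfl⟩
        · exact ⟨1, 0, rfl⟩
        · exact ⟨1, 1, rfl⟩
      obtain ⟨i, j, h⟩ := this
      rw [h]
      exact ⟨_, _, _, gen_mul_comb i j z u v⟩
    | mul f1 f2 h1 h2 =>
      intro y hy
      rw [map_mul, mul_assoc]
      exact h1 _ (h2 _ hy)
    | add f1 f2 h1 h2 =>
      intro y hy
      obtain ⟨z, u, v, h⟩ := h1 y hy
      obtain ⟨z', u', v', h'⟩ := h2 y hy
      rw [map_add, add_mul, h, h']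
      exact ⟨_, _, _, comb_add _ _ _ _ _ _⟩
  obtain ⟨f, rfl⟩ : ∃ f, mkC f = x := RingQuot.mkAlgHom_surjective ℚ relC x
  have := main f 1 ⟨1, 0, 0, by simp [comb]⟩
  rwa [mul_one] at this

theorem phi_comb (z : ℚ) (u v : Fin 2 → Fin 2 → ℚ) :
    phi (comb z u v) =
      (!![z + u 0 0 + v 0 0, u 0 1 + v 0 1; u 1 0 + v 1 0, z + u 1 1 + v 1 1],
       !![z - u 0 0 + v 0 0, -u 0 1 + v 0 1; -u 1 0 + v 1 0, z - u 1 1 + v 1 1], z) := by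
  simp only [comb, map_add, map_smul, map_mul, map_one, phi_g]
  refine Prod.ext ?_ (Prod.ext ?_ ?_)
  · ext i j
    fin_cases i <;> fin_cases j <;> simp [matUnit] <;> ring
  · ext i j
    fin_cases i <;> fin_cases j <;> simp [matUnit] <;> ring
  · simp

theorem phi_inj : Function.Injective phi := by
  rw [injective_iff_map_eq_zero]
  intro x hx
  obtain ⟨z, u, v, rfl⟩ := exists_comb x
  rw [phi_comb] at hx
  have hz : z = 0 := congrArg (fun t : Tgt => t.2.2) hx
  have h1 := congrArg (fun t : Tgt => t.1) hx
  have h2 := congrArg (fun t : Tgt => t.2.1) hx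
  have e1 := fun i j => congrFun (congrFun h1 i) j
  have e2 := fun i j => congrFun (congrFun h2 i) j
  simp [Fin.forall_fin_two] at e1 e2
  obtain ⟨⟨p1, p2⟩, p3, p4⟩ := e1
  obtain ⟨⟨q1, q2⟩, q3, q4⟩ := e2
  have a1 : u 0 0 = 0 := by linarith
  have a2 : u 0 1 = 0 := by linarith
  have a3 : u 1 0 = 0 := by linarith
  have a4 : u 1 1 = 0 := by linarith
  have b1 : v 0 0 = 0 := by linarith
  have b2 : v 0 1 = 0 := by linarith
  have b3 : v 1 0 = 0 := by linarith
  have b4 : v 1 1 = 0 := by linarith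
  simp [comb, hz, a1, a2, a3, a4, b1, b2, b3, b4]

/-- Diagonal coefficient functions. -/
def diagC (r : ℚ) : Fin 2 → Fin 2 → ℚ := fun i j => if i = j then r else 0

theorem combo_eq (x y z : ℚ) :
    x • centerBasisC 0 + y • centerBasisC 1 + z • centerBasisC 2
      = comb x (diagC y) (diagC z) := by
  simp [centerBasisC, comb, diagC, g]

theorem central_comb (x y z : ℚ) :
    comb x (diagC y) (diagC z) ∈ Subalgebra.center ℚ UC := by
  rw [Subalgebra.mem_center_iff]
  intro w
  apply phi_inj
  rw [map_mul, map_mul, phi_comb]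
  refine Prod.ext ?_ (Prod.ext ?_ ?_)
  · ext i j
    fin_cases i <;> fin_cases j <;> simp [diagC, Matrix.mul_apply, mul_comm]
  · ext i j
    fin_cases i <;> fin_cases j <;> simp [diagC, Matrix.mul_apply, mul_comm]
  · simp [mul_comm]

theorem central_only (w : UC) (hw : w ∈ Subalgebra.center ℚ UC) :
    ∃ x y z, w = comb x (diagC y) (diagC z) := by
  rw [Subalgebra.mem_center_iff] at hw
  obtain ⟨z, u, v, rfl⟩ := exists_comb w
  have hb := congrArg phi (hw (g 0 1))
  have hc := congrArg phi (hw (g 1 0))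
  rw [map_mul, map_mul, phi_comb, phi_g] at hb hc
  have b1 := congrArg (fun t : Tgt => t.1) hb
  have b2 := congrArg (fun t : Tgt => t.2.1) hb
  have c1 := congrArg (fun t : Tgt => t.1) hc
  have c2 := congrArg (fun t : Tgt => t.2.1) hc
  have b1' := fun i j => congrFun (congrFun b1 i) j
  have b2' := fun i j => congrFun (congrFun b2 i) j
  have c1' := fun i j => congrFun (congrFun c1 i) j
  have c2' := fun i j => congrFun (congrFun c2 i) j
  have p1 := b1' 0 0
  have p2 := b1' 0 1
  have p3 := b2' 0 0
  have p4 := b2' 0 1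
  have q1 := c1' 0 0
  have q3 := c2' 0 0
  simp [matUnit, Matrix.vecMul, dotProduct, Matrix.single_apply] at p1 p2 p3 p4 q1 q3
  have a2 : u 0 1 = 0 := by linarith
  have a3 : u 1 0 = 0 := by linarith
  have a4 : u 1 1 = u 0 0 := by linarith
  have d2 : v 0 1 = 0 := by linarith
  have d3 : v 1 0 = 0 := by linarith
  have d4 : v 1 1 = v 0 0 := by linarith
  exact ⟨z, u 0 0, v 0 0, by simp [comb, diagC, a2, a3, a4, d2, d3, d4]⟩

theorem basis_li : LinearIndependent ℚ centerBasisC := by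
  rw [Fintype.linearIndependent_iff]
  intro r hr
  rw [Fin.sum_univ_three, combo_eq] at hr
  have hx := congrArg phi hr
  rw [phi_comb, map_zero] at hx
  have hz : r 0 = 0 := congrArg (fun t : Tgt => t.2.2) hx
  have h1 := congrFun (congrFun (congrArg (fun t : Tgt => t.1) hx) 0) 0
  have h2 := congrFun (congrFun (congrArg (fun t : Tgt => t.2.1) hx) 0) 0
  simp [diagC] at h1 h2
  intro i
  fin_cases i
  · exact hz
  · show r 1 = 0
    linarith
  · show r 2 = 0
    linarith

theorem basis_mem (i : Fin 3) : centerBasisC i ∈ Subalgebra.center ℚ UC := by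
  fin_cases i
  · have := combo_eq 1 0 0
    simp only [one_smul, zero_smul, add_zero] at this
    show centerBasisC 0 ∈ _
    rw [this]; exact central_comb _ _ _
  · have := combo_eq 0 1 0
    simp only [one_smul, zero_smul, add_zero, zero_add] at this
    show centerBasisC 1 ∈ _
    rw [this]; exact central_comb _ _ _
  · have := combo_eq 0 0 1
    simp only [one_smul, zero_smul, zero_add] at this
    show centerBasisC 2 ∈ _
    rw [this]; exact central_comb _ _ _

theorem basis_span : Submodule.span ℚ (Set.range centerBasisC) =
    Subalgebra.toSubmodule (Subalgebra.center ℚ UC) := by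
  apply le_antisymm
  · rw [Submodule.span_le]
    rintro _ ⟨i, rfl⟩
    exact basis_mem i
  · intro w hw
    obtain ⟨x, y, z, rfl⟩ := central_only w hw
    rw [← combo_eq]
    have hm : ∀ i, centerBasisC i ∈ Submodule.span ℚ (Set.range centerBasisC) :=
      fun i => Submodule.subset_span ⟨i, rfl⟩
    exact Submodule.add_mem _ (Submodule.add_mem _ (Submodule.smul_mem _ _ (hm 0))
      (Submodule.smul_mem _ _ (hm 1))) (Submodule.smul_mem _ _ (hm 2))

/-- The center of `U(A^C)` is 3-dimensional over ℚ, with basis given by the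
cosets of `1`, `a + d`, and `a² + cb`. -/
theorem center_UC_dimension_three :
    (∀ i, centerBasisC i ∈ Subalgebra.center ℚ UC) ∧
    LinearIndependent ℚ centerBasisC ∧
    Submodule.span ℚ (Set.range centerBasisC) =
      Subalgebra.toSubmodule (Subalgebra.center ℚ UC) ∧
    Module.finrank ℚ (Subalgebra.center ℚ UC) = 3 := by
  refine ⟨basis_mem, basis_li, basis_span, ?_⟩
  have h := finrank_span_eq_card basis_li
  rw [basis_span] at h
  simpa using h
end

section
/- The ideal I^T of ℚ⟨a,b,c,d⟩ equals the two-sided ideal generated by the 16 elements ac, ba, b², bc + ad − a², bd − ab, c², cd, da − ad, db, dc − ca, d² − cb − ad, a²b − b, ca² − c, cab + a²d − a³ − d + a, cad, a³d − a⁴ − ad + a². -/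
/-- The 64 generators `e_ij e_kl e_st − e_kl e_st e_ij − η(⟨E_ij, E_kl, E_st⟩)`
of the ideal `I^T`, coming from the special translator `⟨x,y,z⟩ = xyz − yzx`
on the associative triple system M₂(ℚ). -/
noncomputable def genSetT : Set FreeA :=
  { g | ∃ i j k l s t : Fin 2,
      g = gen i j * gen k l * gen s t - gen k l * gen s t * gen i j
          - eta (matUnit i j * matUnit k l * matUnit s t
                 - matUnit k l * matUnit s t * matUnit i j) }

/-- The two-sided ideal `I^T` of ℚ⟨a,b,c,d⟩. -/
noncomputable def idealT : TwoSidedIdeal FreeA := TwoSidedIdeal.span genSetT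

/-- `η` on the translators of matrix units. -/
theorem eta_translator (i j k l s t : Fin 2) :
    eta (matUnit i j * matUnit k l * matUnit s t - matUnit k l * matUnit s t * matUnit i j) =
      (if j = k ∧ l = s then gen i t else 0) - (if l = s ∧ t = i then gen k j else 0) := by
  have hsub : ∀ x y, eta (x - y) = eta x - eta y := by
    intro x y
    simp only [eta, Matrix.sub_apply, sub_smul, Fin.sum_univ_two]
    abel
  have hz : eta 0 = 0 := by simp [eta]
  have hu : ∀ i j, eta (Matrix.single i j 1) = gen i j := by
    intro i j
    fin_cases i <;> fin_cases j <;> simp [eta, Fin.sum_univ_two, Matrix.single]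
  have ht : ∀ i j k l s t : Fin 2, eta (matUnit i j * matUnit k l * matUnit s t) =
      if j = k ∧ l = s then gen i t else 0 := by
    intro i j k l s t
    unfold matUnit
    by_cases h1 : j = k
    · subst h1
      by_cases h2 : l = s
      · subst h2
        simp [hu]
      · simp [h2, hz]
    · simp [h1, hz]
  rw [hsub, ht, ht]

/-- The sixteen relations, in an arbitrary ring, follow from the translator relations. -/
theorem sixteen_of_translators {R : Type*} [Ring R] (e : Fin 2 → Fin 2 → R)
    (H : ∀ i j k l s t : Fin 2, e i j * e k l * e s t - e k l * e s t * e i j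
      - ((if j = k ∧ l = s then e i t else 0) - (if l = s ∧ t = i then e k j else 0)) = 0)
    (a b c d : R) (ha : e 0 0 = a) (hb : e 0 1 = b) (hc : e 1 0 = c) (hd : e 1 1 = d) :
    a * c = 0 ∧
    b * a = 0 ∧
    b * b = 0 ∧
    b * c + a * d - a * a = 0 ∧
    b * d - a * b = 0 ∧
    c * c = 0 ∧
    c * d = 0 ∧
    d * a - a * d = 0 ∧
    d * b = 0 ∧
    d * c - c * a = 0 ∧
    d * d - c * b - a * d = 0 ∧
    a * a * b - b = 0 ∧
    c * a * a - c = 0 ∧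
    c * a * b + a * a * d - a * a * a - d + a = 0 ∧
    c * a * d = 0 ∧
    a * a * a * d - a * a * a * a - a * d + a * a = 0 := by
  have h_aca : a * c * a - c * a * a - (0 - c) = 0 := by
    simpa [ha, hb, hc, hd] using H 0 0 1 0 0 0
  have h_aac : a * a * c - a * c * a - (0 - 0) = 0 := by
    simpa [ha, hb, hc, hd] using H 0 0 0 0 1 0
  have h_aba : a * b * a - b * a * a - (0 - 0) = 0 := by
    simpa [ha, hb, hc, hd] using H 0 0 0 1 0 0
  have h_aab : a * a * b - a * b * a - (b - 0) = 0 := by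
    simpa [ha, hb, hc, hd] using H 0 0 0 0 0 1
  have h_bab : b * a * b - a * b * b - (0 - 0) = 0 := by
    simpa [ha, hb, hc, hd] using H 0 1 0 0 0 1
  have h_bca : b * c * a - c * a * b - (a - d) = 0 := by
    simpa [ha, hb, hc, hd] using H 0 1 1 0 0 0
  have h_abc : a * b * c - b * c * a - (a - a) = 0 := by
    simpa [ha, hb, hc, hd] using H 0 0 0 1 1 0
  have h_bac : b * a * c - a * c * b - (0 - 0) = 0 := by
    simpa [ha, hb, hc, hd] using H 0 1 0 0 1 0
  have h_bda : b * d * a - d * a * b - (0 - 0) = 0 := by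
    simpa [ha, hb, hc, hd] using H 0 1 1 1 0 0
  have h_aad : a * a * d - a * d * a - (0 - 0) = 0 := by
    simpa [ha, hb, hc, hd] using H 0 0 0 0 1 1
  have h_abd : a * b * d - b * d * a - (b - 0) = 0 := by
    simpa [ha, hb, hc, hd] using H 0 0 0 1 1 1
  have h_bad : b * a * d - a * d * b - (0 - 0) = 0 := by
    simpa [ha, hb, hc, hd] using H 0 1 0 0 1 1
  have h_cac : c * a * c - a * c * c - (0 - 0) = 0 := by
    simpa [ha, hb, hc, hd] using H 1 0 0 0 1 0
  have h_acc : a * c * c - c * c * a - (0 - 0) = 0 := by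
    simpa [ha, hb, hc, hd] using H 0 0 1 0 1 0
  have h_cad : c * a * d - a * d * c - (0 - 0) = 0 := by
    simpa [ha, hb, hc, hd] using H 1 0 0 0 1 1
  have h_adc : a * d * c - d * c * a - (0 - c) = 0 := by
    simpa [ha, hb, hc, hd] using H 0 0 1 1 1 0
  have h_abb : a * b * b - b * b * a - (0 - 0) = 0 := by
    simpa [ha, hb, hc, hd] using H 0 0 0 1 0 1
  have h_bcb : b * c * b - c * b * b - (b - 0) = 0 := by
    simpa [ha, hb, hc, hd] using H 0 1 1 0 0 1
  have h_bbc : b * b * c - b * c * b - (0 - b) = 0 := by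
    simpa [ha, hb, hc, hd] using H 0 1 0 1 1 0
  have h_cbc : c * b * c - b * c * c - (c - 0) = 0 := by
    simpa [ha, hb, hc, hd] using H 1 0 0 1 1 0
  have h_cbd : c * b * d - b * d * c - (d - a) = 0 := by
    simpa [ha, hb, hc, hd] using H 1 0 0 1 1 1
  have h_cdb : c * d * b - d * b * c - (0 - 0) = 0 := by
    simpa [ha, hb, hc, hd] using H 1 0 1 1 0 1
  have h_bcd : b * c * d - c * d * b - (0 - 0) = 0 := by
    simpa [ha, hb, hc, hd] using H 0 1 1 0 1 1
  have r1 : a * c = 0 := by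
    linear_combination (norm := noncomm_ring) a * h_aca - h_aac * a
  have r2 : b * a = 0 := by
    linear_combination (norm := noncomm_ring) a * h_aba - h_aab * a
  have r3 : b * b = 0 := by
    linear_combination (norm := noncomm_ring) - a * h_bab - h_aab * b
  have r4 : b * c + a * d - a * a = 0 := by
    linear_combination (norm := noncomm_ring) a * h_bca - h_aac * b + a * h_abc - a * h_bac - h_aab * c
  have r5 : b * d - a * b = 0 := by
    linear_combination (norm := noncomm_ring) a * h_bda - h_aad * b + a * h_abd - a * h_bad - h_aab * d
  have r6 : c * c = 0 := by
    linear_combination (norm := noncomm_ring) c * h_aac + h_cac * a + h_aca * c + h_aac * c - a * h_acc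
  have r7 : c * d = 0 := by
    linear_combination (norm := noncomm_ring) c * h_aad + h_cad * a + h_aca * d - a * h_adc + a * h_aca - h_aac * a - a * h_cad
  have r8 : d * a - a * d = 0 := by
    linear_combination (norm := noncomm_ring) - c * h_aab + h_bca * a + h_abc * a - h_aca * b - a * h_bca
  have r9 : d * b = 0 := by
    linear_combination (norm := noncomm_ring) c * h_abb - h_bcb * a - h_bbc * a + h_bca * b + h_abc * b - b * h_abc + h_bab * c + a * h_bbc
  have r10 : d * c - c * a = 0 := by
    linear_combination (norm := noncomm_ring) c * h_abc + h_cbc * a + h_bca * c + h_abc * c - b * h_acc + h_bac * c + a * h_cbc + 2 * (a * h_aca) - 2 * (h_aac * a)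
  have r11 : d * d - c * b - a * d = 0 := by
    linear_combination (norm := noncomm_ring) c * h_abd + h_cbd * a + h_bca * d + h_abc * d - b * h_adc + h_bad * c - a * h_cdb - a * h_bcd - h_aac * b + a * h_abc - a * h_bac - h_aab * c - c * h_aab + h_bca * a + h_abc * a - h_aca * b
  have r12 : a * a * b - b = 0 := by
    linear_combination (norm := noncomm_ring) a * h_aba * a - h_aab * a * a + h_aba + h_aab
  have r13 : c * a * a - c = 0 := by
    linear_combination (norm := noncomm_ring) - h_aca + a * h_aca * a - h_aac * a * a
  have r14 : c * a * b + a * a * d - a * a * a - d + a = 0 := by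
    linear_combination (norm := noncomm_ring) - h_bca + a * h_bca * a - h_aac * b * a + a * h_abc * a - a * h_bac * a - h_aab * c * a + h_aad
  have r15 : c * a * d = 0 := by
    linear_combination (norm := noncomm_ring) h_cad + c * h_abc * a + h_cbc * a * a - h_aca + h_bca * c * a + h_abc * c * a + h_adc - b * h_acc * a + h_bac * c * a + a * h_cbc * a + 3 * (a * h_aca * a) - 3 * (h_aac * a * a)
  have r16 : a * a * a * d - a * a * a * a - a * d + a * a = 0 := by
    linear_combination (norm := noncomm_ring) a * a * r4 - r4 - r12 * c
  exact ⟨r1, r2, r3, r4, r5, r6, r7, r8, r9, r10, r11, r12, r13, r14, r15, r16⟩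

/-- The translator relations, in an arbitrary ring, follow from the sixteen relations. -/
theorem translators_of_sixteen {R : Type*} [Ring R] (e : Fin 2 → Fin 2 → R)
    (a b c d : R) (ha : e 0 0 = a) (hb : e 0 1 = b) (hc : e 1 0 = c) (hd : e 1 1 = d)
    (h1 : a * c = 0)
    (h2 : b * a = 0)
    (h3 : b * b = 0)
    (h4 : b * c + a * d - a * a = 0)
    (h5 : b * d - a * b = 0)
    (h6 : c * c = 0)
    (h7 : c * d = 0)
    (h8 : d * a - a * d = 0)
    (h9 : d * b = 0)
    (h10 : d * c - c * a = 0)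
    (h11 : d * d - c * b - a * d = 0)
    (h12 : a * a * b - b = 0)
    (h13 : c * a * a - c = 0)
    (h14 : c * a * b + a * a * d - a * a * a - d + a = 0)
    (h15 : c * a * d = 0)
    (i j k l s t : Fin 2) : e i j * e k l * e s t - e k l * e s t * e i j
      - ((if j = k ∧ l = s then e i t else 0) - (if l = s ∧ t = i then e k j else 0)) = 0 := by
  have s1 : a * c = 0 := by
    linear_combination (norm := noncomm_ring) h1
  have t1 : ∀ x, a * (c * x) = (0) * x := by
    intro x
    rw [← mul_assoc, s1]
  have s2 : b * a = 0 := by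
    linear_combination (norm := noncomm_ring) h2
  have s3 : b * b = 0 := by
    linear_combination (norm := noncomm_ring) h3
  have s4 : b * c = a * a - a * d := by
    linear_combination (norm := noncomm_ring) h4
  have s5 : b * d = a * b := by
    linear_combination (norm := noncomm_ring) h5
  have s6 : c * c = 0 := by
    linear_combination (norm := noncomm_ring) h6
  have s7 : c * d = 0 := by
    linear_combination (norm := noncomm_ring) h7
  have s8 : d * a = a * d := by
    linear_combination (norm := noncomm_ring) h8
  have s9 : d * b = 0 := by
    linear_combination (norm := noncomm_ring) h9
  have s10 : d * c = c * a := by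
    linear_combination (norm := noncomm_ring) h10
  have s11 : d * d = c * b + a * d := by
    linear_combination (norm := noncomm_ring) h11
  have s12 : a * (a * b) = b := by
    linear_combination (norm := noncomm_ring) h12
  have s13 : c * (a * a) = c := by
    linear_combination (norm := noncomm_ring) h13
  have s14 : c * (a * b) = a * (a * a) - a * (a * d) + d - a := by
    linear_combination (norm := noncomm_ring) h14
  have s15 : c * (a * d) = 0 := by
    linear_combination (norm := noncomm_ring) h15
  fin_cases i <;> fin_cases j <;> fin_cases k <;> fin_cases l <;> fin_cases s <;> fin_cases t <;>
    simp [ha, hb, hc, hd, mul_assoc, add_mul, mul_add, sub_mul, mul_sub,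
      s1, t1, s2, s3, s4, s5, s6, s7, s8, s9, s10, s11, s12, s13, s14, s15] <;> abel

/-- Membership in a two-sided ideal is vanishing in the quotient. -/
theorem mem_iff_quot (J : TwoSidedIdeal FreeA) (x : FreeA) :
    x ∈ J ↔ J.ringCon.mk' x = 0 := by
  rw [← TwoSidedIdeal.mem_ker, TwoSidedIdeal.ker_ringCon_mk']

/-- The translator relations lie in any two-sided ideal containing the sixteen elements. -/
theorem translators_mem (J : TwoSidedIdeal FreeA)
    (h1 : gen 0 0 * gen 1 0 ∈ J)
    (h2 : gen 0 1 * gen 0 0 ∈ J)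
    (h3 : gen 0 1 * gen 0 1 ∈ J)
    (h4 : gen 0 1 * gen 1 0 + gen 0 0 * gen 1 1 - gen 0 0 * gen 0 0 ∈ J)
    (h5 : gen 0 1 * gen 1 1 - gen 0 0 * gen 0 1 ∈ J)
    (h6 : gen 1 0 * gen 1 0 ∈ J)
    (h7 : gen 1 0 * gen 1 1 ∈ J)
    (h8 : gen 1 1 * gen 0 0 - gen 0 0 * gen 1 1 ∈ J)
    (h9 : gen 1 1 * gen 0 1 ∈ J)
    (h10 : gen 1 1 * gen 1 0 - gen 1 0 * gen 0 0 ∈ J)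
    (h11 : gen 1 1 * gen 1 1 - gen 1 0 * gen 0 1 - gen 0 0 * gen 1 1 ∈ J)
    (h12 : gen 0 0 * gen 0 0 * gen 0 1 - gen 0 1 ∈ J)
    (h13 : gen 1 0 * gen 0 0 * gen 0 0 - gen 1 0 ∈ J)
    (h14 : gen 1 0 * gen 0 0 * gen 0 1 + gen 0 0 * gen 0 0 * gen 1 1 - gen 0 0 * gen 0 0 * gen 0 0 - gen 1 1 + gen 0 0 ∈ J)
    (h15 : gen 1 0 * gen 0 0 * gen 1 1 ∈ J)
    (i j k l s t : Fin 2) : gen i j * gen k l * gen s t - gen k l * gen s t * gen i j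
      - ((if j = k ∧ l = s then gen i t else 0) - (if l = s ∧ t = i then gen k j else 0)) ∈ J := by
  rw [mem_iff_quot] at *
  simp only [map_sub, map_mul, map_add] at *
  have H := translators_of_sixteen (fun i j => J.ringCon.mk' (gen i j)) _ _ _ _ rfl rfl rfl rfl
    h1 h2 h3 h4 h5 h6 h7 h8 h9 h10 h11 h12 h13 h14 h15 i j k l s t
  simpa only [apply_ite J.ringCon.mk', map_zero] using H

/-- The ideal `I^T` equals the two-sided ideal generated by the 16 listed elements,
where `a = e₁₁, b = e₁₂, c = e₂₁, d = e₂₂`. -/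
theorem idealT_eq_span_sixteen :
    idealT = TwoSidedIdeal.span
      (let a := gen 0 0; let b := gen 0 1; let c := gen 1 0; let d := gen 1 1
       {a * c, b * a, b * b, b * c + a * d - a * a, b * d - a * b, c * c, c * d,
        d * a - a * d, d * b, d * c - c * a, d * d - c * b - a * d,
        a * a * b - b, c * a * a - c,
        c * a * b + a * a * d - a * a * a - d + a, c * a * d,
        a * a * a * d - a * a * a * a - a * d + a * a}) := by
  apply le_antisymm
  · unfold idealT
    rw [TwoSidedIdeal.span_le]
    rintro g ⟨i, j, k, l, s, t, rfl⟩
    rw [eta_translator]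
    refine translators_mem _ ?_ ?_ ?_ ?_ ?_ ?_ ?_ ?_ ?_ ?_ ?_ ?_ ?_ ?_ ?_ i j k l s t <;>
      (apply TwoSidedIdeal.subset_span; simp only [Set.mem_insert_iff, true_or, or_true])
  · rw [TwoSidedIdeal.span_le]
    have H := sixteen_of_translators (fun i j => idealT.ringCon.mk' (gen i j)) (by
      intro i j k l s t
      have h : _ ∈ idealT := TwoSidedIdeal.subset_span ⟨i, j, k, l, s, t, rfl⟩
      rw [eta_translator, mem_iff_quot] at h
      simpa only [map_sub, map_mul, apply_ite idealT.ringCon.mk', map_zero] using h)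
      _ _ _ _ rfl rfl rfl rfl
    simp only [← map_mul, ← map_sub, ← map_add, ← mem_iff_quot] at H
    obtain ⟨r1, r2, r3, r4, r5, r6, r7, r8, r9, r10, r11, r12, r13, r14, r15, r16⟩ := H
    rintro x (hx | hx | hx | hx | hx | hx | hx | hx | hx | hx | hx | hx | hx | hx | hx | hx) <;>
      (subst hx; assumption)
end

section
/- In the universal associative enveloping algebra U(A^T) = ℚ⟨a,b,c,d⟩/I^T, for every integer k ≥ 3 the relation a^k·d = a^{k+1} + a^{k−2}·d − a^{k−1} holds; that is, a^k·d − a^{k+1} − a^{k−2}·d + a^{k−1} ∈ I^T for all k ≥ 3. Moreover, (ad)·(ad) − (a⁴ + ad − a²) ∈ I^T, (ad)·(a²d) − (a⁵ − a³ + a²d) ∈ I^T, and (a²d)·(a²d) − (a⁶ + ad − a²) ∈ I^T. -/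
/-- The consequences of the defining relations, in an arbitrary ring. -/
lemma ring_rel {R : Type*} [Ring R] (a b c d : R)
    (had : a * a * d = a * d * a) (hbd : b * a * d = a * d * b) (hcd : c * a * d = a * d * c)
    (hda : a * d * a = d * a * a) (hac : a * a * c = a * c * a) (hbc : b * a * c = a * c * b)
    (hcda : a * c * d = c * d * a)
    (hbca : b * c * a - c * a * b = a - d) (hbaa : b * a * a - a * a * b = -b) :
    a ^ 3 * d = a ^ 4 + a * d - a ^ 2 ∧ (a * d) * (a * d) = a ^ 3 * d := by
  have h1 : a * (a - d) = a * b * (c * a - a * c) := by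
    have e : a * c * (a * b) = a * b * (a * c) := by
      calc a * c * (a * b) = (a * c * a) * b := by noncomm_ring
        _ = a * (a * c * b) := by rw [← hac]; noncomm_ring
        _ = a * b * (a * c) := by rw [← hbc]; noncomm_ring
    calc a * (a - d) = a * b * (c * a) - a * c * (a * b) := by rw [← hbca]; noncomm_ring
      _ = _ := by rw [e]; noncomm_ring
  have h2 : a * a * (c * a - a * c) = 0 := by
    calc a * a * (c * a - a * c) = a * a * c * a - a * (a * a * c) := by noncomm_ring
      _ = a * a * c * a - (a * a * c) * a := by nth_rewrite 2 [hac]; noncomm_ring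
      _ = 0 := sub_self _
  have h3 : a * a * b = b * a * a + b := by
    rw [sub_eq_iff_eq_add] at hbaa
    rw [hbaa]; abel
  have h4 : a * a * (a * (a - d)) = a * (a - d) := by
    calc a * a * (a * (a - d)) = a * (a * a * b) * (c * a - a * c) := by rw [h1]; noncomm_ring
      _ = a * b * (a * a * (c * a - a * c)) + a * b * (c * a - a * c) := by
          rw [h3]; noncomm_ring
      _ = a * (a - d) := by rw [h2, h1]; simp
  have h5 : a * d * (c * a) = a * d * (a * c) := by
    calc a * d * (c * a) = (a * d * c) * a := by noncomm_ring
      _ = c * (a * a * d) := by rw [← hcd, had]; noncomm_ring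
      _ = (c * d * a) * a := by rw [had, hda]; noncomm_ring
      _ = (a * c * d) * a := by rw [hcda]
      _ = a * (c * d * a) := by noncomm_ring
      _ = (a * a * c) * d := by rw [← hcda]; noncomm_ring
      _ = a * (c * a * d) := by rw [hac]; noncomm_ring
      _ = (a * a * d) * c := by rw [hcd]; noncomm_ring
      _ = a * d * (a * c) := by rw [had]; noncomm_ring
  have h6 : a * d * (a * (a - d)) = 0 := by
    calc a * d * (a * (a - d)) = (a * d * a) * b * (c * a - a * c) := by rw [h1]; noncomm_ring
      _ = a * (a * d * b) * (c * a - a * c) := by rw [← had]; noncomm_ring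
      _ = a * b * (a * d * (c * a) - a * d * (a * c)) := by rw [← hbd]; noncomm_ring
      _ = 0 := by rw [h5]; simp
  constructor
  · have : a ^ 4 - a ^ 3 * d = a ^ 2 - a * d := by
      calc a ^ 4 - a ^ 3 * d = a * a * (a * (a - d)) := by noncomm_ring
        _ = _ := by rw [h4]; noncomm_ring
    rw [sub_eq_iff_eq_add] at this
    rw [this]; abel
  · have : a * d * (a * a) - a * d * (a * d) = 0 := by
      rw [← h6]; noncomm_ring
    rw [← sub_eq_zero.mp this]
    calc a * d * (a * a) = (a * d * a) * a := by noncomm_ring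
      _ = (a * a * d) * a := by rw [had]
      _ = a * (a * d * a) := by noncomm_ring
      _ = a ^ 3 * d := by rw [← had]; noncomm_ring

lemma mem_idealT_iff (x : FreeA) : x ∈ idealT ↔ idealT.ringCon.mk' x = 0 := by
  rw [← TwoSidedIdeal.mem_ker, TwoSidedIdeal.ker_ringCon_mk']

lemma quot_rel (i j k l s t : Fin 2) :
    idealT.ringCon.mk' (gen i j * gen k l * gen s t - gen k l * gen s t * gen i j
      - eta (matUnit i j * matUnit k l * matUnit s t
        - matUnit k l * matUnit s t * matUnit i j)) = 0 :=
  (mem_idealT_iff _).1 (TwoSidedIdeal.subset_span ⟨i, j, k, l, s, t, rfl⟩)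

/-- In `U(A^T) = ℚ⟨a,b,c,d⟩/I^T`: for every `k ≥ 3` the relation
`a^k·d = a^(k+1) + a^(k−2)·d − a^(k−1)` holds, together with the square relations
`(ad)² = a⁴ + ad − a²`, `(ad)(a²d) = a⁵ − a³ + a²d`, `(a²d)² = a⁶ + ad − a²`;
that is, the corresponding differences lie in the ideal `I^T`. -/
theorem UT_power_relations :
    (∀ k : ℕ, 3 ≤ k →
      (gen 0 0) ^ k * (gen 1 1) - (gen 0 0) ^ (k + 1)
        - (gen 0 0) ^ (k - 2) * (gen 1 1) + (gen 0 0) ^ (k - 1) ∈ idealT) ∧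
    ((gen 0 0 * gen 1 1) * (gen 0 0 * gen 1 1)
      - ((gen 0 0) ^ 4 + gen 0 0 * gen 1 1 - (gen 0 0) ^ 2) ∈ idealT) ∧
    ((gen 0 0 * gen 1 1) * ((gen 0 0) ^ 2 * gen 1 1)
      - ((gen 0 0) ^ 5 - (gen 0 0) ^ 3 + (gen 0 0) ^ 2 * gen 1 1) ∈ idealT) ∧
    (((gen 0 0) ^ 2 * gen 1 1) * ((gen 0 0) ^ 2 * gen 1 1)
      - ((gen 0 0) ^ 6 + gen 0 0 * gen 1 1 - (gen 0 0) ^ 2) ∈ idealT) := by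
  have hz : ∀ i j k l s t : Fin 2,
      matUnit i j * matUnit k l * matUnit s t - matUnit k l * matUnit s t * matUnit i j = 0 →
      idealT.ringCon.mk' (gen i j) * idealT.ringCon.mk' (gen k l) * idealT.ringCon.mk' (gen s t)
        = idealT.ringCon.mk' (gen k l) * idealT.ringCon.mk' (gen s t)
          * idealT.ringCon.mk' (gen i j) := by
    intro i j k l s t h
    have := quot_rel i j k l s t
    rw [h] at this
    simpa [eta, sub_eq_zero] using this
  have key := ring_rel (idealT.ringCon.mk' (gen 0 0)) (idealT.ringCon.mk' (gen 0 1))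
    (idealT.ringCon.mk' (gen 1 0)) (idealT.ringCon.mk' (gen 1 1))
    (hz 0 0 0 0 1 1 (by simp [matUnit])) (hz 0 1 0 0 1 1 (by simp [matUnit]))
    (hz 1 0 0 0 1 1 (by simp [matUnit])) (hz 0 0 1 1 0 0 (by simp [matUnit]))
    (hz 0 0 0 0 1 0 (by simp [matUnit])) (hz 0 1 0 0 1 0 (by simp [matUnit]))
    (hz 0 0 1 0 1 1 (by simp [matUnit]))
    (by
      have := quot_rel 0 1 1 0 0 0
      have e : eta (matUnit 0 1 * matUnit 1 0 * matUnit 0 0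
          - matUnit 1 0 * matUnit 0 0 * matUnit 0 1) = gen 0 0 - gen 1 1 := by
        simp [eta, matUnit, Fin.sum_univ_two, Matrix.single_apply, sub_eq_add_neg]
      rw [e] at this
      simpa only [map_sub, map_mul, sub_eq_zero] using this)
    (by
      have := quot_rel 0 1 0 0 0 0
      have e : eta (matUnit 0 1 * matUnit 0 0 * matUnit 0 0
          - matUnit 0 0 * matUnit 0 0 * matUnit 0 1) = - gen 0 1 := by
        simp [eta, matUnit, Fin.sum_univ_two, Matrix.single_apply]
      rw [e] at this
      simpa only [map_sub, map_mul, map_neg, sub_eq_zero] using this)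
  have had := hz 0 0 0 0 1 1 (by simp [matUnit])
  simp only [mem_idealT_iff, map_sub, map_add, map_mul, map_pow]
  generalize idealT.ringCon.mk' (gen 0 0) = a at *
  generalize idealT.ringCon.mk' (gen 1 1) = d at *
  obtain ⟨k3, k2⟩ := key
  have k4 : a ^ 4 * d = a ^ 5 + a ^ 2 * d - a ^ 3 := by
    calc a ^ 4 * d = a * (a ^ 3 * d) := by noncomm_ring
      _ = _ := by rw [k3]; noncomm_ring
  have k5 : a ^ 5 * d = a ^ 6 + a * d - a ^ 2 := by
    calc a ^ 5 * d = a * (a ^ 4 * d) := by noncomm_ring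
      _ = a ^ 6 + a ^ 3 * d - a ^ 4 := by rw [k4]; noncomm_ring
      _ = _ := by rw [k3]; abel
  have k23 : a * d * (a ^ 2 * d) = a ^ 4 * d := by
    calc a * d * (a ^ 2 * d) = (a * d * a) * (a * d) := by noncomm_ring
      _ = a * (a * d * (a * d)) := by rw [← had]; noncomm_ring
      _ = a ^ 4 * d := by rw [k2]; noncomm_ring
  refine ⟨?_, ?_, ?_, ?_⟩
  · intro k hk
    obtain ⟨m, rfl⟩ := Nat.exists_eq_add_of_le' hk
    have e1 : m + 3 - 2 = m + 1 := by omega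
    have e2 : m + 3 - 1 = m + 2 := by omega
    have e3 : m + 3 + 1 = m + 4 := by omega
    rw [e1, e2, e3, pow_add a m 3, pow_add a m 4, pow_add a m 1, pow_add a m 2, mul_assoc, k3]
    noncomm_ring
  · rw [k2, k3]; abel
  · rw [k23, k4]; abel
  · have : a ^ 2 * d * (a ^ 2 * d) = a ^ 5 * d := by
      calc a ^ 2 * d * (a ^ 2 * d) = a * (a * d * (a ^ 2 * d)) := by noncomm_ring
        _ = _ := by rw [k23]; noncomm_ring
    rw [this, k5]; abel
end

section
/- The ideal I^{CT} of ℚ⟨a,b,c,d⟩ equals the ideal I^C; consequently the universal associative enveloping algebras U(A^{CT}) = ℚ⟨a,b,c,d⟩/I^{CT} and U(A^C) = ℚ⟨a,b,c,d⟩/I^C are isomorphic as ℚ-algebras. -/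
/-- The two-sided ideal `I^{CT}` of ℚ⟨a,b,c,d⟩, generated by the commutator
generators and the translator generators together. -/
noncomputable def idealCT : TwoSidedIdeal FreeA :=
  TwoSidedIdeal.span (genSetC ∪ genSetT)

/-- The relation yielding `U(A^{CT}) = ℚ⟨a,b,c,d⟩/I^{CT}`. -/
noncomputable def relCT : FreeA → FreeA → Prop :=
  fun x y => x ∈ genSetC ∪ genSetT ∧ y = 0

/-- The universal associative enveloping algebra `U(A^{CT})`. -/
noncomputable abbrev UCT : Type := RingQuot relCT

section helpers
variable {A : Type*} [Ring A] [Algebra ℚ A] (e : Matrix (Fin 2) (Fin 2) ℚ →ₗ[ℚ] A)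

/-- Defect of `e` from being multiplicative on triples. -/
def defect (X Y V : Matrix (Fin 2) (Fin 2) ℚ) : A := e X * e Y * e V - e (X * Y * V)

theorem defect_add (X Y Y' V : Matrix (Fin 2) (Fin 2) ℚ) :
    defect e X (Y + Y') V = defect e X Y V + defect e X Y' V := by
  simp only [defect, map_add, mul_add, add_mul]; abel

theorem defect_smul (r : ℚ) (X Y V : Matrix (Fin 2) (Fin 2) ℚ) :
    defect e X (r • Y) V = r • defect e X Y V := by
  simp only [defect, map_smul, mul_smul_comm, smul_mul_assoc, smul_sub]

theorem defect_swap (h : ∀ X Y Z, e X * e Y * e Z - e Y * e X * e Z = e (X * Y * Z - Y * X * Z))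
    (X Y V : Matrix (Fin 2) (Fin 2) ℚ) : defect e X Y V = defect e Y X V := by
  have := h X Y V
  rw [map_sub] at this
  simp only [defect]
  rw [sub_eq_sub_iff_add_eq_add] at this ⊢
  rw [this]; abel

theorem defect_comm (h : ∀ X Y Z, e X * e Y * e Z - e Y * e X * e Z = e (X * Y * Z - Y * X * Z))
    (X Y W Z V : Matrix (Fin 2) (Fin 2) ℚ) :
    defect e W ((X * Y - Y * X) * Z) V = defect e Z ((X * Y - Y * X) * W) V := by
  rw [defect_swap e h W, defect_swap e h Z]
  have hc : ∀ Q, (e X * e Y - e Y * e X) * e Q = e ((X * Y - Y * X) * Q) := fun Q => by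
    rw [sub_mul, h X Y Q, sub_mul]
  have h1 := hc (Z * W * V - W * Z * V)
  rw [← h Z W V] at h1
  simp only [defect]
  rw [← hc Z, ← hc W, sub_eq_sub_iff_sub_eq_sub, ← map_sub]
  calc _ = (e X * e Y - e Y * e X) * (e Z * e W * e V - e W * e Z * e V) := by noncomm_ring
    _ = _ := h1
    _ = _ := by congr 1; noncomm_ring

theorem defect_all (h : ∀ X Y Z, e X * e Y * e Z - e Y * e X * e Z = e (X * Y * Z - Y * X * Z))
    (P W Z V : Matrix (Fin 2) (Fin 2) ℚ) :
    defect e W (P * Z) V = defect e Z (P * W) V := by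
  have hP : P = ((P 0 0 + P 1 1) / 2) • (1 : Matrix (Fin 2) (Fin 2) ℚ)
      + (((P 0 0 - P 1 1) / 2) • (!![0,1;0,0] * !![0,0;1,0] - !![0,0;1,0] * !![0,1;0,0])
      + (P 0 1 • (!![1,0;0,0] * !![0,1;0,0] - !![0,1;0,0] * !![1,0;0,0])
      + P 1 0 • (!![0,0;0,1] * !![0,0;1,0] - !![0,0;1,0] * !![0,0;0,1]))) := by
    ext i j
    fin_cases i <;> fin_cases j <;> simp <;> ring
  rw [hP]
  simp only [add_mul, smul_mul_assoc, one_mul, defect_add, defect_smul]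
  rw [defect_comm e h _ _ W Z, defect_comm e h _ _ W Z, defect_comm e h _ _ W Z,
    defect_swap e h W Z]

theorem defect_zero (h : ∀ X Y Z, e X * e Y * e Z - e Y * e X * e Z = e (X * Y * Z - Y * X * Z))
    (X Y V : Matrix (Fin 2) (Fin 2) ℚ) : defect e X Y V = 0 := by
  have h1 : ∀ W P, defect e W P V = defect e 1 (P * W) V := fun W P => by
    simpa using defect_all e h P W 1 V
  have h2 : ∀ P W Z, defect e 1 (P * (Z * W) - P * (W * Z)) V = 0 := fun P W Z => by
    have := defect_all e h P W Z V
    rw [h1, h1 Z, mul_assoc, mul_assoc] at this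
    rw [sub_eq_add_neg, ← neg_one_smul ℚ (P * (W * Z)), defect_add, defect_smul, this]
    simp
  rw [h1]
  have h3 := h2 ((Y * X) * !![1,0;0,-1]) !![0,0;1,0] !![0,1;0,0]
  rw [← mul_sub, mul_assoc] at h3
  have : (!![1,0;0,-1] * (!![0,1;0,0] * !![0,0;1,0] - !![0,0;1,0] * !![0,1;0,0]) :
      Matrix (Fin 2) (Fin 2) ℚ) = 1 := by
    ext i j
    fin_cases i <;> fin_cases j <;> simp
  rwa [this, mul_one] at h3

/-- Extension of the commutator relations from matrix units to all matrices. -/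
theorem comm_extend (h : ∀ i j k l s t, e (matUnit i j) * e (matUnit k l) * e (matUnit s t)
      - e (matUnit k l) * e (matUnit i j) * e (matUnit s t)
      = e (matUnit i j * matUnit k l * matUnit s t - matUnit k l * matUnit i j * matUnit s t))
    (X Y Z : Matrix (Fin 2) (Fin 2) ℚ) :
    e X * e Y * e Z - e Y * e X * e Z = e (X * Y * Z - Y * X * Z) := by
  have hs : ∀ (i j : Fin 2) (x : ℚ), Matrix.single i j x = x • matUnit i j := fun i j x => by
    simp [matUnit, Matrix.smul_single]
  induction X using Matrix.induction_on' with
  | h_zero => simp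
  | h_add p q hp hq =>
    simp only [map_add, add_mul, mul_add, map_sub] at *
    rw [add_sub_add_comm, hp, hq]; abel
  | h_std_basis i j x =>
  induction Y using Matrix.induction_on' with
  | h_zero => simp
  | h_add p q hp hq =>
    simp only [map_add, add_mul, mul_add, map_sub] at *
    rw [add_sub_add_comm, hp, hq]; abel
  | h_std_basis k l y =>
  induction Z using Matrix.induction_on' with
  | h_zero => simp
  | h_add p q hp hq =>
    simp only [map_add, mul_add, map_sub] at *
    rw [add_sub_add_comm, hp, hq]; abel
  | h_std_basis s t z =>
    have := h i j k l s t
    rw [hs, hs, hs]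
    simp only [map_smul, smul_mul_assoc, mul_smul_comm, map_sub] at *
    rw [smul_comm y x, ← smul_sub, ← smul_sub, ← smul_sub, this, smul_comm y x]
    simp only [smul_sub]

end helpers

/-- `eta` as a linear map. -/
noncomputable def etaL : Matrix (Fin 2) (Fin 2) ℚ →ₗ[ℚ] FreeA where
  toFun := eta
  map_add' x y := by simp only [eta, Matrix.add_apply, add_smul, Finset.sum_add_distrib]
  map_smul' r x := by
    simp only [eta, Matrix.smul_apply, smul_eq_mul, mul_smul, Finset.smul_sum, RingHom.id_apply]

/-- Any algebra map killing the commutator generators kills the translator generators. -/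
theorem kills {A : Type*} [Ring A] [Algebra ℚ A] (φ : FreeA →ₐ[ℚ] A)
    (h : ∀ g ∈ genSetC, φ g = 0) : ∀ g ∈ genSetT, φ g = 0 := by
  have hu : ∀ i j, (φ.toLinearMap ∘ₗ etaL) (matUnit i j) = φ (gen i j) := fun i j =>
    congrArg φ (eta_matUnit i j)
  have hx : ∀ X, (φ.toLinearMap ∘ₗ etaL) X = φ (eta X) := fun X => rfl
  have hd := defect_zero (φ.toLinearMap ∘ₗ etaL) (comm_extend _ (fun i j k l s t => by
    have := h _ ⟨i, j, k, l, s, t, rfl⟩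
    rw [map_sub, sub_eq_zero] at this
    rw [hu, hu, hu, hx, ← this]
    simp))
  rintro g ⟨i, j, k, l, s, t, rfl⟩
  have a1 := hd (matUnit i j) (matUnit k l) (matUnit s t)
  have a2 := hd (matUnit k l) (matUnit s t) (matUnit i j)
  simp only [defect, sub_eq_zero, hu] at a1 a2
  rw [map_sub, ← hx, map_sub (φ.toLinearMap ∘ₗ etaL), ← a1, ← a2]
  simp

/-- The ideal `I^{CT}` equals `I^C`; consequently `U(A^{CT})` and `U(A^C)` are
isomorphic as ℚ-algebras. -/
theorem idealCT_eq_idealC_and_UCT_iso_UC :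
    idealCT = idealC ∧ Nonempty (UCT ≃ₐ[ℚ] UC) := by
  constructor
  · apply le_antisymm
    · refine TwoSidedIdeal.span_le.mpr (Set.union_subset TwoSidedIdeal.subset_span ?_)
      have key := kills (A := idealC.ringCon.Quotient)
        { idealC.ringCon.mk' with commutes' := fun r => rfl } (fun g hg => by
          have : g ∈ idealC := TwoSidedIdeal.subset_span hg
          exact (RingCon.eq _).mpr ((TwoSidedIdeal.mem_iff _ _).mp this))
      intro g hg
      exact (TwoSidedIdeal.mem_iff _ _).mpr ((RingCon.eq _).mp (key g hg))
    · exact TwoSidedIdeal.span_mono Set.subset_union_left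
  · have hC : ∀ g ∈ genSetC, RingQuot.mkAlgHom ℚ relC g = 0 := fun g hg => by
      rw [RingQuot.mkAlgHom_rel ℚ (show relC g 0 from ⟨hg, rfl⟩), map_zero]
    have hT := kills (RingQuot.mkAlgHom ℚ relC) hC
    refine ⟨AlgEquiv.ofAlgHom
      (RingQuot.liftAlgHom ℚ ⟨RingQuot.mkAlgHom ℚ relC, ?_⟩)
      (RingQuot.liftAlgHom ℚ ⟨RingQuot.mkAlgHom ℚ relCT, ?_⟩) ?_ ?_⟩
    · rintro x y ⟨hx, rfl⟩
      rw [map_zero]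
      exact hx.elim (hC x) (hT x)
    · rintro x y ⟨hx, rfl⟩
      exact RingQuot.mkAlgHom_rel ℚ (show relCT x 0 from ⟨Or.inl hx, rfl⟩)
    · apply RingQuot.ringQuot_ext'
      ext; simp
    · apply RingQuot.ringQuot_ext'
      ext; simp
end
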